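/- (Uniqueness in the fluid variables, Theorem 3.3.) Let (η₁, λ₁, r₁, s₁) and (η₂, λ₂, r₂, s₂) be two regular solutions on [1,T) with the same initial data at t = 1, and for i = 1,2 define the mass-energy density μᵢ = √(rᵢ sᵢ) and, at points where rᵢ + sᵢ > 0, the scalar velocity uᵢ = (√rᵢ − √sᵢ)/(√rᵢ + √sᵢ). Then at every point (t,x) ∈ [1,T) × ℝ one has μ₁(t,x) = μ₂(t,x), and at every point where μ₁(t,x) > 0 one also has u₁(t,x) = u₂(t,x); in particular either μ₁ = μ₂ > 0 and u₁ = u₂, or μ₁ = μ₂ = 0 at the point (the velocity being then undetermined). -/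

import Mathlib

open Real Set MeasureTheory

noncomputable section

/-- Partial derivative with respect to the time variable `t`. -/
def pderivT (f : ℝ → ℝ → ℝ) (t x : ℝ) : ℝ := deriv (fun τ => f τ x) t

/-- Partial derivative with respect to the space variable `x`. -/
def pderivX (f : ℝ → ℝ → ℝ) (t x : ℝ) : ℝ := deriv (fun y => f t y) x

/-- The time interval `[1, T)` for a (possibly infinite) final time `T ∈ (1,∞]`. -/
def timeSlab (T : EReal) : Set ℝ := {t : ℝ | 1 ≤ t ∧ (t : EReal) < T}

/-- A regular solution of the plane-symmetric Einstein–stiff fluid equations in areal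
coordinates, with cosmological constant `Λ`, on a time interval `J`:
continuously differentiable functions `η, λ, r, s`, 1-periodic in the space variable,
with `r ≥ 0`, `s ≥ 0`, satisfying the evolution and constraint equations (E1)–(E5). -/
structure RegularSolution (Λ : ℝ) (J : Set ℝ) where
  η : ℝ → ℝ → ℝ
  lam : ℝ → ℝ → ℝ
  r : ℝ → ℝ → ℝ
  s : ℝ → ℝ → ℝ
  η_c1 : ContDiffOn ℝ 1 (fun p : ℝ × ℝ => η p.1 p.2) (J ×ˢ (Set.univ : Set ℝ))
  lam_c1 : ContDiffOn ℝ 1 (fun p : ℝ × ℝ => lam p.1 p.2) (J ×ˢ (Set.univ : Set ℝ))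
  r_c1 : ContDiffOn ℝ 1 (fun p : ℝ × ℝ => r p.1 p.2) (J ×ˢ (Set.univ : Set ℝ))
  s_c1 : ContDiffOn ℝ 1 (fun p : ℝ × ℝ => s p.1 p.2) (J ×ˢ (Set.univ : Set ℝ))
  η_per : ∀ t ∈ J, ∀ x : ℝ, η t (x + 1) = η t x
  lam_per : ∀ t ∈ J, ∀ x : ℝ, lam t (x + 1) = lam t x
  r_per : ∀ t ∈ J, ∀ x : ℝ, r t (x + 1) = r t x
  s_per : ∀ t ∈ J, ∀ x : ℝ, s t (x + 1) = s t x
  r_nonneg : ∀ t ∈ J, ∀ x : ℝ, 0 ≤ r t x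
  s_nonneg : ∀ t ∈ J, ∀ x : ℝ, 0 ≤ s t x
  eqE1 : ∀ t ∈ J, ∀ x : ℝ,
    Real.exp (-2 * η t x) * (2 * t * pderivT lam t x + 1) - Λ * t ^ 2
      = 4 * Real.pi * t ^ 2 * (r t x + s t x)
  eqE2 : ∀ t ∈ J, ∀ x : ℝ,
    Real.exp (-2 * η t x) * (2 * t * pderivT η t x - 1) + Λ * t ^ 2
      = 4 * Real.pi * t ^ 2 * (r t x + s t x)
  eqE3 : ∀ t ∈ J, ∀ x : ℝ,
    pderivX η t x = -(2 * Real.pi * t * Real.exp (lam t x + η t x) * (r t x - s t x))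
  eqE4 : ∀ t ∈ J, ∀ x : ℝ,
    pderivT r t x + Real.exp (η t x - lam t x) * pderivX r t x
      = -2 * (pderivT lam t x + Real.exp (η t x - lam t x) * pderivX η t x + 1 / t) * r t x
        - 2 / t * Real.sqrt (r t x * s t x)
  eqE5 : ∀ t ∈ J, ∀ x : ℝ,
    pderivT s t x - Real.exp (η t x - lam t x) * pderivX s t x
      = -2 * (pderivT lam t x - Real.exp (η t x - lam t x) * pderivX η t x + 1 / t) * s t x
        - 2 / t * Real.sqrt (r t x * s t x)

section Slab

variable {f g k : ℝ → ℝ → ℝ} {a b : ℝ}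

/-- Continuous differentiability on the slab `[a, b] × ℝ`, one-sided at the ends. -/
def SlabC1 (a b : ℝ) (f : ℝ → ℝ → ℝ) : Prop :=
  ContDiffOn ℝ 1 (fun p : ℝ × ℝ => f p.1 p.2) (Icc a b ×ˢ (univ : Set ℝ))

/-- The partial derivatives of a `C¹` function on a slab extend continuously up to the ends. -/
lemma SlabC1.exists_partials (hf : SlabC1 a b f) (hab : a < b) :
    ∃ ft fx : ℝ × ℝ → ℝ, ContinuousOn ft (Icc a b ×ˢ (univ : Set ℝ)) ∧
      ContinuousOn fx (Icc a b ×ˢ (univ : Set ℝ)) ∧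
      ∀ t ∈ Ioo a b, ∀ x, HasDerivAt (fun τ => f τ x) (ft (t, x)) t ∧
        HasDerivAt (fun y => f t y) (fx (t, x)) x := by
  have hu : UniqueDiffOn ℝ (Icc a b ×ˢ (univ : Set ℝ)) :=
    (uniqueDiffOn_Icc hab).prod uniqueDiffOn_univ
  set S := Icc a b ×ˢ (univ : Set ℝ) with hS
  set F : ℝ × ℝ → ℝ := fun p => f p.1 p.2 with hF
  have hc := hf.continuousOn_fderivWithin hu le_rfl
  refine ⟨fun p => fderivWithin ℝ F S p (1, 0), fun p => fderivWithin ℝ F S p (0, 1),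
    hc.clm_apply continuousOn_const, hc.clm_apply continuousOn_const, fun t ht x => ?_⟩
  have hn : S ∈ nhds (t, x) := prod_mem_nhds (Icc_mem_nhds ht.1 ht.2) Filter.univ_mem
  have hd : HasFDerivAt F (fderivWithin ℝ F S (t, x)) (t, x) :=
    ((hf.differentiableOn one_ne_zero) (t, x) (mem_of_mem_nhds hn)).hasFDerivWithinAt.hasFDerivAt hn
  constructor
  · exact HasFDerivAt.comp_hasDerivAt (f := fun τ : ℝ => (τ, x)) t hd
      ((hasDerivAt_id t).prodMk (hasDerivAt_const t x))
  · exact HasFDerivAt.comp_hasDerivAt (f := fun y : ℝ => (t, y)) x hd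
      ((hasDerivAt_const x t).prodMk (hasDerivAt_id x))

lemma SlabC1.hasDerivAt_pderivT (hf : SlabC1 a b f) {t : ℝ} (ht : t ∈ Ioo a b) (x : ℝ) :
    HasDerivAt (fun τ => f τ x) (pderivT f t x) t := by
  obtain ⟨ft, fx, -, -, h⟩ := hf.exists_partials (ht.1.trans ht.2)
  exact (h t ht x).1.differentiableAt.hasDerivAt

lemma SlabC1.hasDerivAt_pderivX (hf : SlabC1 a b f) {t : ℝ} (ht : t ∈ Ioo a b) (x : ℝ) :
    HasDerivAt (fun y => f t y) (pderivX f t x) x := by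
  obtain ⟨ft, fx, -, -, h⟩ := hf.exists_partials (ht.1.trans ht.2)
  exact (h t ht x).2.differentiableAt.hasDerivAt

lemma continuous_slice {F : ℝ × ℝ → ℝ} (hF : ContinuousOn F (Icc a b ×ˢ (univ : Set ℝ))) {t : ℝ}
    (ht : t ∈ Icc a b) : Continuous fun x => F (t, x) :=
  hF.comp_continuous (by fun_prop) fun x => ⟨ht, mem_univ x⟩

lemma SlabC1.continuous_slice (hf : SlabC1 a b f) {t : ℝ} (ht : t ∈ Icc a b) :
    Continuous (f t) :=
  _root_.continuous_slice hf.continuousOn ht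

lemma SlabC1.continuous_pderivT (hf : SlabC1 a b f) {t : ℝ} (ht : t ∈ Ioo a b) :
    Continuous (pderivT f t) := by
  obtain ⟨ft, fx, hft, -, h⟩ := hf.exists_partials (ht.1.trans ht.2)
  have : pderivT f t = fun x => ft (t, x) := funext fun x => (h t ht x).1.deriv
  exact this ▸ _root_.continuous_slice hft (Ioo_subset_Icc_self ht)

lemma SlabC1.continuous_pderivX (hf : SlabC1 a b f) {t : ℝ} (ht : t ∈ Ioo a b) :
    Continuous (pderivX f t) := by
  obtain ⟨ft, fx, -, hfx, h⟩ := hf.exists_partials (ht.1.trans ht.2)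
  have : pderivX f t = fun x => fx (t, x) := funext fun x => (h t ht x).2.deriv
  exact this ▸ _root_.continuous_slice hfx (Ioo_subset_Icc_self ht)

lemma exists_slab_bound {F : ℝ × ℝ → ℝ} (hF : ContinuousOn F (Icc a b ×ˢ (univ : Set ℝ)))
    (c d : ℝ) : ∃ M, 0 ≤ M ∧ ∀ t ∈ Icc a b, ∀ x ∈ Icc c d, |F (t, x)| ≤ M := by
  obtain ⟨M, hM⟩ := (isCompact_Icc.prod isCompact_Icc : IsCompact (Icc a b ×ˢ Icc c d)
    ).exists_bound_of_continuousOn (hF.mono (prod_mono_right (subset_univ _)))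
  exact ⟨max M 0, le_max_right _ _, fun t ht x hx => (hM (t, x) ⟨ht, hx⟩).trans (le_max_left _ _)⟩

/-- A `C¹` function on a slab and its partial derivatives are bounded on compact boxes. -/
lemma SlabC1.exists_bound (hf : SlabC1 a b f) (hab : a < b) (c d : ℝ) :
    ∃ M, 0 ≤ M ∧ ∀ t ∈ Ioo a b, ∀ x ∈ Icc c d,
      |f t x| ≤ M ∧ |pderivT f t x| ≤ M ∧ |pderivX f t x| ≤ M := by
  obtain ⟨ft, fx, hft, hfx, h⟩ := hf.exists_partials hab
  obtain ⟨M₁, h₁, hM₁⟩ := exists_slab_bound hf.continuousOn c d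
  obtain ⟨M₂, h₂, hM₂⟩ := exists_slab_bound hft c d
  obtain ⟨M₃, h₃, hM₃⟩ := exists_slab_bound hfx c d
  refine ⟨M₁ + M₂ + M₃, by positivity, fun t ht x hx => ?_⟩
  have ht' := Ioo_subset_Icc_self ht
  have e₁ : pderivT f t x = ft (t, x) := (h t ht x).1.deriv
  have e₂ : pderivX f t x = fx (t, x) := (h t ht x).2.deriv
  rw [e₁, e₂]
  exact ⟨(hM₁ t ht' x hx).trans (by linarith), (hM₂ t ht' x hx).trans (by linarith),
    (hM₃ t ht' x hx).trans (by linarith)⟩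

lemma SlabC1.continuousOn_integral (hf : SlabC1 a b f) {c d : ℝ} (hcd : c ≤ d) :
    ContinuousOn (fun t => ∫ x in c..d, f t x) (Icc a b) := by
  obtain ⟨M, -, hM⟩ := exists_slab_bound hf.continuousOn c d
  intro t ht
  refine intervalIntegral.continuousWithinAt_of_dominated_interval (bound := fun _ => M)
    ?_ ?_ intervalIntegrable_const ?_
  · filter_upwards [self_mem_nhdsWithin] with τ hτ
    exact (hf.continuous_slice hτ).aestronglyMeasurable
  · filter_upwards [self_mem_nhdsWithin] with τ hτ
    refine Filter.Eventually.of_forall fun x hx => ?_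
    rw [uIoc_of_le hcd] at hx
    exact hM τ hτ x (Ioc_subset_Icc_self hx)
  · refine Filter.Eventually.of_forall fun x _ => ?_
    exact ContinuousWithinAt.comp (f := fun τ : ℝ => (τ, x))
      (hf.continuousOn (t, x) ⟨ht, mem_univ x⟩)
      (by fun_prop) fun τ hτ => ⟨hτ, mem_univ x⟩

lemma SlabC1.hasDerivAt_integral (hf : SlabC1 a b f) {c d : ℝ} (hcd : c ≤ d) {t : ℝ}
    (ht : t ∈ Ioo a b) :
    HasDerivAt (fun t => ∫ x in c..d, f t x) (∫ x in c..d, pderivT f t x) t := by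
  obtain ⟨M, -, hM⟩ := hf.exists_bound (ht.1.trans ht.2) c d
  have hn : Ioo a b ∈ nhds t := Ioo_mem_nhds ht.1 ht.2
  refine (intervalIntegral.hasDerivAt_integral_of_dominated_loc_of_deriv_le
    (F' := pderivT f) (bound := fun _ => M) hn ?_
    ((hf.continuous_slice (Ioo_subset_Icc_self ht)).intervalIntegrable _ _)
    (hf.continuous_pderivT ht).aestronglyMeasurable ?_ intervalIntegrable_const ?_).2
  · filter_upwards [hn] with τ hτ
    exact (hf.continuous_slice (Ioo_subset_Icc_self hτ)).aestronglyMeasurable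
  · refine Filter.Eventually.of_forall fun x hx τ hτ => ?_
    rw [uIoc_of_le hcd] at hx
    exact (hM τ hτ x (Ioc_subset_Icc_self hx)).2.1
  · exact Filter.Eventually.of_forall fun x _ τ hτ => hf.hasDerivAt_pderivT hτ x

lemma SlabC1.integral_pderivX_eq_zero (hk : SlabC1 a b k) {c p : ℝ}
    (hper : ∀ t ∈ Icc a b, ∀ x, k t (x + p) = k t x) {t : ℝ} (ht : t ∈ Ioo a b) :
    ∫ x in c..(c + p), pderivX k t x = 0 := by
  rw [intervalIntegral.integral_eq_sub_of_hasDerivAt (f := k t)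
    (fun x _ => hk.hasDerivAt_pderivX ht x) ((hk.continuous_pderivX ht).intervalIntegrable _ _),
    hper t (Ioo_subset_Icc_self ht), sub_self]

/-- Gronwall estimate for the integral over one period of a density `g` which satisfies a
differential inequality up to the divergence of a periodic flux `k`. -/
lemma SlabC1.integral_le_of_pderiv_le (hg : SlabC1 a b g) (hk : SlabC1 a b k) (hab : a < b)
    {c p C D : ℝ} (hp : 0 ≤ p) (hC : 0 ≤ C) (hD : 0 ≤ D)
    (hper : ∀ t ∈ Icc a b, ∀ x, k t (x + p) = k t x)
    (h : ∀ t ∈ Ioo a b, ∀ x ∈ Icc c (c + p), pderivT g t x + pderivX k t x ≤ C * g t x + D) :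
    ∫ x in c..(c + p), g b x ≤
      exp (C * (b - a)) * ((∫ x in c..(c + p), g a x) + p * D * (b - a)) := by
  have hcp : c ≤ c + p := by linarith
  set G : ℝ → ℝ := fun t => ∫ x in c..(c + p), g t x with hG
  have hder : ∀ t ∈ Ioo a b, ∫ x in c..(c + p), pderivT g t x ≤ C * G t + p * D := by
    intro t ht
    have hint := (hg.continuous_pderivT ht).intervalIntegrable (μ := volume) c (c + p)
    have hint' := (hk.continuous_pderivX ht).intervalIntegrable (μ := volume) c (c + p)
    have hgi := (hg.continuous_slice (Ioo_subset_Icc_self ht)).intervalIntegrable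
      (μ := volume) c (c + p)
    calc ∫ x in c..(c + p), pderivT g t x
        = ∫ x in c..(c + p), (pderivT g t x + pderivX k t x) := by
          rw [intervalIntegral.integral_add hint hint', hk.integral_pderivX_eq_zero hper ht,
            add_zero]
      _ ≤ ∫ x in c..(c + p), (C * g t x + D) :=
          intervalIntegral.integral_mono_on hcp (hint.add hint')
            ((hgi.const_mul C).add intervalIntegrable_const) (h t ht)
      _ = C * G t + p * D := by
          rw [intervalIntegral.integral_add (hgi.const_mul C) intervalIntegrable_const]
          simp [hG]
  have hdF : ∀ t ∈ Ioo a b, HasDerivAt (fun t => exp (-(C * (t - a))) * G t - p * D * (t - a))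
      (exp (-(C * (t - a))) * -C * G t
        + exp (-(C * (t - a))) * (∫ x in c..(c + p), pderivT g t x) - p * D) t := by
    intro t ht
    have h₁ : HasDerivAt (fun t => exp (-(C * (t - a)))) (exp (-(C * (t - a))) * -C) t := by
      have := (((hasDerivAt_id t).sub_const a).const_mul C).neg.exp
      simpa using this
    have h₂ : HasDerivAt (fun t => p * D * (t - a)) (p * D) t := by
      simpa using ((hasDerivAt_id t).sub_const a).const_mul (p * D)
    exact (h₁.mul (hg.hasDerivAt_integral hcp ht)).sub h₂
  have hanti : AntitoneOn (fun t => exp (-(C * (t - a))) * G t - p * D * (t - a)) (Icc a b) := by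
    refine antitoneOn_of_deriv_nonpos (convex_Icc a b) ?_ ?_ ?_
    · have := hg.continuousOn_integral (c := c) (d := c + p) hcp
      fun_prop
    · rw [interior_Icc]
      exact fun t ht => (hdF t ht).differentiableAt.differentiableWithinAt
    · rw [interior_Icc]
      intro t ht
      rw [(hdF t ht).deriv]
      have he : exp (-(C * (t - a))) ≤ 1 := by
        rw [exp_le_one_iff]
        have := mul_nonneg hC (sub_nonneg.2 ht.1.le)
        linarith
      have h₁ := mul_le_mul_of_nonneg_left (hder t ht) (exp_pos (-(C * (t - a)))).le
      have h₂ := mul_le_mul_of_nonneg_right he (mul_nonneg hp hD)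
      linarith
  have hfin := hanti (left_mem_Icc.2 hab.le) (right_mem_Icc.2 hab.le) hab.le
  simp only [sub_self, mul_zero, neg_zero, exp_zero, one_mul, sub_zero] at hfin
  have h₃ : exp (C * (b - a)) * exp (-(C * (b - a))) = 1 := by rw [← exp_add]; simp
  calc G b = exp (C * (b - a)) * (exp (-(C * (b - a))) * G b) := by rw [← mul_assoc, h₃, one_mul]
    _ ≤ _ := mul_le_mul_of_nonneg_left (by linarith) (exp_pos _).le

end Slab

section Entropy

/-- A smooth convex regularization of the absolute value. -/
def smoothAbs (ε z : ℝ) : ℝ := sqrt (z ^ 2 + ε ^ 2)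

/-- The derivative of `smoothAbs ε`, a regularization of the sign. -/
def smoothSign (ε z : ℝ) : ℝ := z / sqrt (z ^ 2 + ε ^ 2)

variable {ε : ℝ}

lemma abs_le_smoothAbs (ε z : ℝ) : |z| ≤ smoothAbs ε z :=
  abs_le_sqrt (by linarith [sq_nonneg ε])

lemma smoothAbs_zero (hε : 0 < ε) : smoothAbs ε 0 = ε := by
  simp [smoothAbs, sqrt_sq hε.le]

lemma contDiff_smoothAbs (hε : 0 < ε) : ContDiff ℝ 1 (smoothAbs ε) :=
  ContDiff.sqrt (by fun_prop) fun z => by positivity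

lemma hasDerivAt_smoothAbs (hε : 0 < ε) (z : ℝ) :
    HasDerivAt (smoothAbs ε) (smoothSign ε z) z := by
  have h : HasDerivAt (fun z : ℝ => z ^ 2 + ε ^ 2) (2 * z) z := by
    simpa using (hasDerivAt_pow 2 z).add_const (ε ^ 2)
  refine (h.sqrt (by positivity)).congr_deriv ?_
  unfold smoothSign
  rw [mul_div_mul_left _ _ two_ne_zero]

lemma abs_smoothSign_le_one (ε z : ℝ) : |smoothSign ε z| ≤ 1 := by
  rw [smoothSign, abs_div, abs_of_nonneg (sqrt_nonneg _)]
  exact div_le_one_of_le₀ (abs_le_smoothAbs ε z) (sqrt_nonneg _)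

lemma smoothSign_neg (ε z : ℝ) : smoothSign ε (-z) = -smoothSign ε z := by
  simp [smoothSign, neg_div]

lemma smoothSign_mul_self_nonneg (ε z : ℝ) : 0 ≤ smoothSign ε z * z := by
  rw [smoothSign, div_mul_eq_mul_div]
  exact div_nonneg (mul_self_nonneg z) (sqrt_nonneg _)

lemma smoothSign_nonneg (ε : ℝ) {z : ℝ} (hz : 0 ≤ z) : 0 ≤ smoothSign ε z :=
  div_nonneg hz (sqrt_nonneg _)

lemma one_sub_smoothSign_mul_sqrt_le (hε : 0 < ε) {z : ℝ} (hz : 0 ≤ z) :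
    (1 - smoothSign ε z) * sqrt z ≤ sqrt ε := by
  have h₁ := (abs_le.1 (abs_smoothSign_le_one ε z)).2
  have h₀ := smoothSign_nonneg ε hz
  refine le_sqrt_of_sq_le ?_
  rw [mul_pow, sq_sqrt hz]
  have hq : 0 < sqrt (z ^ 2 + ε ^ 2) := sqrt_pos.2 (by positivity)
  have hle : sqrt (z ^ 2 + ε ^ 2) ≤ z + ε :=
    sqrt_le_iff.2 ⟨by positivity, by nlinarith [mul_nonneg hz hε.le]⟩
  have hzq : z = smoothSign ε z * sqrt (z ^ 2 + ε ^ 2) := by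
    rw [smoothSign, div_mul_cancel₀ _ hq.ne']
  have : (1 - smoothSign ε z) * z ≤ ε := by
    have : (1 - smoothSign ε z) * z ≤ (1 - smoothSign ε z) * sqrt (z ^ 2 + ε ^ 2) :=
      mul_le_mul_of_nonneg_left (le_of_abs_le (abs_le_smoothAbs ε z)) (by linarith)
    linarith
  nlinarith [mul_nonneg (sub_nonneg.2 h₁) hz]

lemma neg_smoothSign_add_mul_le_of_le {M r₁ r₂ s₁ s₂ : ℝ} (hε : 0 < ε) (hr : r₂ ≤ r₁)
    (hr₂ : 0 ≤ r₂) (hM : s₂ ≤ M)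
    (hD : 0 ≤ sqrt (r₁ * s₁) - sqrt (r₂ * s₂)) :
    -((smoothSign ε (r₁ - r₂) + smoothSign ε (s₁ - s₂)) * (sqrt (r₁ * s₁) - sqrt (r₂ * s₂)))
      ≤ sqrt M * sqrt ε := by
  have hR : 0 ≤ r₁ - r₂ := sub_nonneg.2 hr
  rcases le_total s₂ s₁ with hs | hs
  · have := mul_nonneg (add_nonneg (smoothSign_nonneg ε hR)
      (smoothSign_nonneg ε (sub_nonneg.2 hs))) hD
    have : 0 ≤ sqrt M * sqrt ε := by positivity
    linarith
  · have h₁ := (abs_le.1 (abs_smoothSign_le_one ε (r₁ - r₂))).2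
    have h₂ := (abs_le.1 (abs_smoothSign_le_one ε (s₁ - s₂))).1
    have hsub : sqrt r₁ ≤ sqrt (r₁ - r₂) + sqrt r₂ := by
      refine sqrt_le_iff.2 ⟨by positivity, ?_⟩
      have := mul_nonneg (sqrt_nonneg (r₁ - r₂)) (sqrt_nonneg r₂)
      nlinarith [sq_sqrt hR, sq_sqrt hr₂]
    have hDle : sqrt (r₁ * s₁) - sqrt (r₂ * s₂) ≤ sqrt M * sqrt (r₁ - r₂) := by
      have hle : sqrt (r₁ * s₁) ≤ sqrt r₁ * sqrt s₂ := by
        rw [← sqrt_mul (hr₂.trans hr)]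
        exact sqrt_le_sqrt (mul_le_mul_of_nonneg_left hs (hr₂.trans hr))
      rw [sqrt_mul hr₂]
      have := mul_le_mul_of_nonneg_right hsub (sqrt_nonneg s₂)
      have := mul_le_mul_of_nonneg_right (sqrt_le_sqrt hM) (sqrt_nonneg (r₁ - r₂))
      linarith
    calc _ ≤ (1 - smoothSign ε (r₁ - r₂)) * (sqrt (r₁ * s₁) - sqrt (r₂ * s₂)) := by
            nlinarith
      _ ≤ (1 - smoothSign ε (r₁ - r₂)) * (sqrt M * sqrt (r₁ - r₂)) :=
            mul_le_mul_of_nonneg_left hDle (by linarith)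
      _ = sqrt M * ((1 - smoothSign ε (r₁ - r₂)) * sqrt (r₁ - r₂)) := by ring
      _ ≤ sqrt M * sqrt ε :=
            mul_le_mul_of_nonneg_left (one_sub_smoothSign_mul_sqrt_le hε hR) (sqrt_nonneg _)

/-- The interaction term `√(rs)` is dissipative in `L¹`, up to an error vanishing with `ε`:
when `r₁ - r₂` and `s₁ - s₂` have the same sign it decreases both, and otherwise its two
contributions cancel. -/
lemma neg_smoothSign_add_mul_le {M r₁ r₂ s₁ s₂ : ℝ} (hε : 0 < ε) (hr₁ : 0 ≤ r₁) (hr₂ : 0 ≤ r₂)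
    (hs₁ : 0 ≤ s₁) (hs₂ : 0 ≤ s₂) (hMr₁ : r₁ ≤ M) (hMr₂ : r₂ ≤ M) (hMs₁ : s₁ ≤ M)
    (hMs₂ : s₂ ≤ M) :
    -((smoothSign ε (r₁ - r₂) + smoothSign ε (s₁ - s₂)) * (sqrt (r₁ * s₁) - sqrt (r₂ * s₂)))
      ≤ sqrt M * sqrt ε := by
  wlog hD : 0 ≤ sqrt (r₁ * s₁) - sqrt (r₂ * s₂) generalizing r₁ r₂ s₁ s₂
  · have := this hr₂ hr₁ hs₂ hs₁ hMr₂ hMr₁ hMs₂ hMs₁ (by linarith)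
    rw [← neg_sub r₁ r₂, ← neg_sub s₁ s₂, smoothSign_neg, smoothSign_neg] at this
    linarith
  rcases le_total r₂ r₁ with hr | hr
  · exact neg_smoothSign_add_mul_le_of_le hε hr hr₂ hMs₂ hD
  rcases le_total s₂ s₁ with hs | hs
  · rw [mul_comm r₁, mul_comm r₂] at hD ⊢
    rw [add_comm]
    exact neg_smoothSign_add_mul_le_of_le hε hs hs₂ hMr₂ hD
  · have h0 : sqrt (r₁ * s₁) - sqrt (r₂ * s₂) = 0 :=
      le_antisymm (sub_nonpos.2 (sqrt_le_sqrt (mul_le_mul hr hs hs₁ hr₂))) hD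
    rw [h0]
    simp only [mul_zero, neg_zero]
    positivity

end Entropy

section Lipschitz

lemma ContDiff.exists_norm_sub_le_of_norm_le {E : Type*} [NormedAddCommGroup E] [NormedSpace ℝ E]
    [ProperSpace E] {F : E → ℝ} (hF : ContDiff ℝ 1 F) (M : ℝ) :
    ∃ K, 0 ≤ K ∧ ∀ p q, ‖p‖ ≤ M → ‖q‖ ≤ M → ‖F p - F q‖ ≤ K * ‖p - q‖ := by
  obtain ⟨K, hK⟩ := (isCompact_closedBall (0 : E) M).exists_bound_of_continuousOn
    (hF.continuous_fderiv one_ne_zero).continuousOn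
  refine ⟨max K 0, le_max_right _ _, fun p q hp hq => ?_⟩
  exact (convex_closedBall (0 : E) M).norm_image_sub_le_of_norm_fderiv_le
    (fun x _ => (hF.differentiable one_ne_zero).differentiableAt)
    (fun x hx => (hK x hx).trans (le_max_left _ _)) (by simpa using hq) (by simpa using hp)

/-- Local Lipschitz continuity of `C¹` functions of `(t, η, λ, r, s)` in the last four variables. -/
lemma ContDiff.exists_abs_sub_le {F : ℝ × ℝ × ℝ × ℝ × ℝ → ℝ} (hF : ContDiff ℝ 1 F) (M : ℝ) :
    ∃ K, 0 ≤ K ∧ ∀ t h l r s h' l' r' s' : ℝ, |t| ≤ M → |h| ≤ M → |l| ≤ M → |r| ≤ M → |s| ≤ M →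
      |h'| ≤ M → |l'| ≤ M → |r'| ≤ M → |s'| ≤ M →
      |F (t, h, l, r, s) - F (t, h', l', r', s')|
        ≤ K * (|h - h'| + |l - l'| + |r - r'| + |s - s'|) := by
  obtain ⟨K, hK₀, hK⟩ := hF.exists_norm_sub_le_of_norm_le M
  refine ⟨K, hK₀, fun t h l r s h' l' r' s' ht hh hl hr hs hh' hl' hr' hs' => ?_⟩
  refine (hK (t, h, l, r, s) (t, h', l', r', s') ?_ ?_).trans
    (mul_le_mul_of_nonneg_left ?_ hK₀)
  · simp [Prod.norm_def, *]
  · simp [Prod.norm_def, *]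
  · have h₁ := abs_nonneg (h - h')
    have h₂ := abs_nonneg (l - l')
    have h₃ := abs_nonneg (r - r')
    have h₄ := abs_nonneg (s - s')
    simp only [Prod.norm_def, Prod.fst_sub, Prod.snd_sub, sub_self, Real.norm_eq_abs, abs_zero,
      sup_le_iff]
    refine ⟨?_, ?_, ?_, ?_, ?_⟩ <;> linarith

end Lipschitz

section Reduction

/-- The speed of the characteristics as a function of `(t, η, λ, r, s)`. -/
def charSpeed (p : ℝ × ℝ × ℝ × ℝ × ℝ) : ℝ := exp (p.2.1 - p.2.2.1)

/-- The rate `∂ₜη - 1/(2t)` as a function of `(t, η, λ, r, s)`. -/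
def etaRate (Λ : ℝ) (p : ℝ × ℝ × ℝ × ℝ × ℝ) : ℝ :=
  exp (2 * p.2.1) * (4 * π * p.1 * (p.2.2.2.1 + p.2.2.2.2) - Λ * p.1) / 2

/-- The rate `∂ₜλ + 1/(2t)` as a function of `(t, η, λ, r, s)`. -/
def lamRate (Λ : ℝ) (p : ℝ × ℝ × ℝ × ℝ × ℝ) : ℝ :=
  exp (2 * p.2.1) * (4 * π * p.1 * (p.2.2.2.1 + p.2.2.2.2) + Λ * p.1) / 2

/-- The smooth part of the damping of `r`, as a function of `(t, η, λ, r, s)`. -/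
def rDamping (Λ : ℝ) (p : ℝ × ℝ × ℝ × ℝ × ℝ) : ℝ :=
  exp (2 * p.2.1) * (8 * π * p.1 * p.2.2.2.2 + Λ * p.1) * p.2.2.2.1

/-- The smooth part of the damping of `s`, as a function of `(t, η, λ, r, s)`. -/
def sDamping (Λ : ℝ) (p : ℝ × ℝ × ℝ × ℝ × ℝ) : ℝ :=
  exp (2 * p.2.1) * (8 * π * p.1 * p.2.2.2.1 + Λ * p.1) * p.2.2.2.2

lemma contDiff_charSpeed : ContDiff ℝ 1 charSpeed := by unfold charSpeed; fun_prop

lemma contDiff_etaRate (Λ : ℝ) : ContDiff ℝ 1 (etaRate Λ) := by unfold etaRate; fun_prop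

lemma contDiff_lamRate (Λ : ℝ) : ContDiff ℝ 1 (lamRate Λ) := by unfold lamRate; fun_prop

lemma contDiff_rDamping (Λ : ℝ) : ContDiff ℝ 1 (rDamping Λ) := by unfold rDamping; fun_prop

lemma contDiff_sDamping (Λ : ℝ) : ContDiff ℝ 1 (sDamping Λ) := by unfold sDamping; fun_prop

namespace RegularSolution

variable {Λ : ℝ} {J : Set ℝ} (u : RegularSolution Λ J)

/-- The time together with the values of the unknowns at a point. -/
def state (t x : ℝ) : ℝ × ℝ × ℝ × ℝ × ℝ := (t, u.η t x, u.lam t x, u.r t x, u.s t x)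

variable {t : ℝ}

lemma exp_two_mul_exp_neg (h : ℝ) : exp (2 * h) * exp (-2 * h) = 1 := by
  rw [← exp_add]; simp

lemma pderivT_η_eq (ht : t ∈ J) (ht₀ : 0 < t) (x : ℝ) :
    pderivT u.η t x = etaRate Λ (u.state t x) + 1 / (2 * t) := by
  have h := u.eqE2 t ht x
  have he := exp_two_mul_exp_neg (u.η t x)
  have h2 : 2 * t * pderivT u.η t x - 1
      = exp (2 * u.η t x) * (4 * π * t ^ 2 * (u.r t x + u.s t x) - Λ * t ^ 2) := by
    linear_combination exp (2 * u.η t x) * h - (2 * t * pderivT u.η t x - 1) * he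
  simp only [etaRate, state]
  field_simp
  linear_combination h2

lemma pderivT_lam_eq (ht : t ∈ J) (ht₀ : 0 < t) (x : ℝ) :
    pderivT u.lam t x = lamRate Λ (u.state t x) - 1 / (2 * t) := by
  have h := u.eqE1 t ht x
  have he := exp_two_mul_exp_neg (u.η t x)
  have h2 : 2 * t * pderivT u.lam t x + 1
      = exp (2 * u.η t x) * (4 * π * t ^ 2 * (u.r t x + u.s t x) + Λ * t ^ 2) := by
    linear_combination exp (2 * u.η t x) * h - (2 * t * pderivT u.lam t x + 1) * he
  simp only [lamRate, state]
  field_simp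
  linear_combination h2

lemma exp_mul_pderivX_η (ht : t ∈ J) (x : ℝ) :
    exp (u.η t x - u.lam t x) * pderivX u.η t x
      = -(2 * π * t * exp (2 * u.η t x) * (u.r t x - u.s t x)) := by
  have he : exp (u.η t x - u.lam t x) * exp (u.lam t x + u.η t x) = exp (2 * u.η t x) := by
    rw [← exp_add]; ring_nf
  rw [u.eqE3 t ht x]
  linear_combination -(2 * π * t * (u.r t x - u.s t x)) * he

lemma transport_r (ht : t ∈ J) (ht₀ : 0 < t) (x : ℝ) :
    pderivT u.r t x + charSpeed (u.state t x) * pderivX u.r t x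
      = -rDamping Λ (u.state t x) - 1 / t * u.r t x
        - 2 / t * sqrt (u.r t x * u.s t x) := by
  have h := u.eqE4 t ht x
  rw [u.exp_mul_pderivX_η ht x, u.pderivT_lam_eq ht ht₀ x] at h
  simp only [charSpeed, rDamping, lamRate, state] at h ⊢
  rw [h]
  field_simp
  ring

lemma transport_s (ht : t ∈ J) (ht₀ : 0 < t) (x : ℝ) :
    pderivT u.s t x - charSpeed (u.state t x) * pderivX u.s t x
      = -sDamping Λ (u.state t x) - 1 / t * u.s t x
        - 2 / t * sqrt (u.r t x * u.s t x) := by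
  have h := u.eqE5 t ht x
  rw [u.exp_mul_pderivX_η ht x, u.pderivT_lam_eq ht ht₀ x] at h
  simp only [charSpeed, sDamping, lamRate, state] at h ⊢
  rw [h]
  field_simp
  ring

end RegularSolution

end Reduction

section Energy

lemma mul_le_of_abs_le {a b A B : ℝ} (ha : |a| ≤ A) (hb : |b| ≤ B) : a * b ≤ A * B :=
  (le_abs_self _).trans <| (abs_mul a b).trans_le <|
    mul_le_mul ha hb (abs_nonneg _) ((abs_nonneg _).trans ha)

/-- The pointwise differential inequality for the regularized `L¹` distance, in terms of the
values of the differences `H, L, R, S` and of their derivatives. -/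
lemma energy_rate_le {ε t H L R S Ht Lt Rt St Rx Sx a ax da r₂x s₂x p₁ p₂ p₄ p₅ D K A M Q : ℝ}
    (ht : 1 ≤ t) (hK : 0 ≤ K) (hM : 0 ≤ M)
    (hH : Ht = p₁) (hL : Lt = p₂)
    (hR : Rt + a * Rx = -p₄ - 1 / t * R - 2 / t * D - da * r₂x)
    (hS : St - a * Sx = -p₅ - 1 / t * S - 2 / t * D + da * s₂x)
    (hp₁ : |p₁| ≤ K * (|H| + |L| + |R| + |S|)) (hp₂ : |p₂| ≤ K * (|H| + |L| + |R| + |S|))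
    (hp₄ : |p₄| ≤ K * (|H| + |L| + |R| + |S|)) (hp₅ : |p₅| ≤ K * (|H| + |L| + |R| + |S|))
    (hda : |da| ≤ K * (|H| + |L| + |R| + |S|)) (hr₂x : |r₂x| ≤ M) (hs₂x : |s₂x| ≤ M)
    (hax : |ax| ≤ A) (hQ₀ : 0 ≤ Q)
    (hQ : -((smoothSign ε R + smoothSign ε S) * D) ≤ Q) :
    smoothSign ε H * Ht + smoothSign ε L * Lt + smoothSign ε R * Rt + smoothSign ε S * St
        + (ax * (smoothAbs ε R - smoothAbs ε S)
          + a * (smoothSign ε R * Rx - smoothSign ε S * Sx))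
      ≤ (4 * K + 2 * K * M + A)
          * (smoothAbs ε H + smoothAbs ε L + smoothAbs ε R + smoothAbs ε S) + 2 * Q := by
  set n := |H| + |L| + |R| + |S| with hn
  set e := smoothAbs ε H + smoothAbs ε L + smoothAbs ε R + smoothAbs ε S with he
  have hH₀ : 0 ≤ smoothAbs ε H := sqrt_nonneg _
  have hL₀ : 0 ≤ smoothAbs ε L := sqrt_nonneg _
  have hR₀ : 0 ≤ smoothAbs ε R := sqrt_nonneg _
  have hS₀ : 0 ≤ smoothAbs ε S := sqrt_nonneg _
  have hne : n ≤ e := by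
    have := abs_le_smoothAbs ε H
    have := abs_le_smoothAbs ε L
    have := abs_le_smoothAbs ε R
    have := abs_le_smoothAbs ε S
    linarith
  have h₁ := mul_le_of_abs_le (abs_smoothSign_le_one ε H) hp₁
  have h₂ := mul_le_of_abs_le (abs_smoothSign_le_one ε L) hp₂
  have h₄ := mul_le_of_abs_le (abs_smoothSign_le_one ε R) ((abs_neg p₄).trans_le hp₄)
  have h₅ := mul_le_of_abs_le (abs_smoothSign_le_one ε S) ((abs_neg p₅).trans_le hp₅)
  have hKn : 0 ≤ K * n := by positivity
  have hdr : |-(da * r₂x)| ≤ K * n * M := by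
    rw [abs_neg, abs_mul]; exact mul_le_mul hda hr₂x (abs_nonneg _) hKn
  have hds : |da * s₂x| ≤ K * n * M := by
    rw [abs_mul]; exact mul_le_mul hda hs₂x (abs_nonneg _) hKn
  have h₆ := mul_le_of_abs_le (abs_smoothSign_le_one ε R) hdr
  have h₇ := mul_le_of_abs_le (abs_smoothSign_le_one ε S) hds
  have h₈ : ax * (smoothAbs ε R - smoothAbs ε S) ≤ A * e :=
    mul_le_of_abs_le hax (abs_le.2 ⟨by linarith, by linarith⟩)
  have ht₀ : 0 < t := by linarith
  have h₉ : 0 ≤ 1 / t * (smoothSign ε R * R) :=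
    mul_nonneg (by positivity) (smoothSign_mul_self_nonneg ε R)
  have h₁₀ : 0 ≤ 1 / t * (smoothSign ε S * S) :=
    mul_nonneg (by positivity) (smoothSign_mul_self_nonneg ε S)
  have h₁₁ : 2 / t * -((smoothSign ε R + smoothSign ε S) * D) ≤ 2 * Q :=
    (mul_le_mul_of_nonneg_left hQ (by positivity)).trans
      (mul_le_mul_of_nonneg_right (div_le_self zero_le_two ht) hQ₀)
  have hKe : K * n ≤ K * e := mul_le_mul_of_nonneg_left hne hK
  have hKMe : K * n * M ≤ K * e * M := mul_le_mul_of_nonneg_right hKe hM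
  have hsplit : smoothSign ε R * Rt + smoothSign ε S * St
      + a * (smoothSign ε R * Rx - smoothSign ε S * Sx)
      = smoothSign ε R * -p₄ - 1 / t * (smoothSign ε R * R) + smoothSign ε R * -(da * r₂x)
        + (smoothSign ε S * -p₅ - 1 / t * (smoothSign ε S * S) + smoothSign ε S * (da * s₂x))
        + 2 / t * -((smoothSign ε R + smoothSign ε S) * D) := by
    linear_combination smoothSign ε R * hR + smoothSign ε S * hS
  rw [hH, hL]
  linarith

end Energy

namespace RegularSolution

variable {Λ : ℝ} {J : Set ℝ} {b ε : ℝ}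

lemma slabC1 (u : RegularSolution Λ J) (hJ : Icc 1 b ⊆ J) :
    SlabC1 1 b u.η ∧ SlabC1 1 b u.lam ∧ SlabC1 1 b u.r ∧ SlabC1 1 b u.s := by
  have hS := prod_mono_left (t := (univ : Set ℝ)) hJ
  exact ⟨u.η_c1.mono hS, u.lam_c1.mono hS, u.r_c1.mono hS, u.s_c1.mono hS⟩

/-- The regularized `L¹` density of the difference of two solutions. -/
def energy (u v : RegularSolution Λ J) (ε t x : ℝ) : ℝ :=
  smoothAbs ε (u.η t x - v.η t x) + smoothAbs ε (u.lam t x - v.lam t x)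
    + smoothAbs ε (u.r t x - v.r t x) + smoothAbs ε (u.s t x - v.s t x)

/-- The flux associated with `energy`. -/
def flux (u v : RegularSolution Λ J) (ε t x : ℝ) : ℝ :=
  exp (u.η t x - u.lam t x)
    * (smoothAbs ε (u.r t x - v.r t x) - smoothAbs ε (u.s t x - v.s t x))

lemma slabC1_smoothAbs_sub {f g : ℝ → ℝ → ℝ} {a : ℝ} (hε : 0 < ε) (hf : SlabC1 a b f)
    (hg : SlabC1 a b g) : SlabC1 a b fun t x => smoothAbs ε (f t x - g t x) :=
  (contDiff_smoothAbs hε).comp_contDiffOn (ContDiffOn.sub hf hg)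

variable (u v : RegularSolution Λ J)

lemma slabC1_energy (hJ : Icc 1 b ⊆ J) (hε : 0 < ε) : SlabC1 1 b (energy u v ε) := by
  obtain ⟨hu₁, hu₂, hu₃, hu₄⟩ := u.slabC1 hJ
  obtain ⟨hv₁, hv₂, hv₃, hv₄⟩ := v.slabC1 hJ
  exact (((slabC1_smoothAbs_sub hε hu₁ hv₁).add (slabC1_smoothAbs_sub hε hu₂ hv₂)).add
    (slabC1_smoothAbs_sub hε hu₃ hv₃)).add (slabC1_smoothAbs_sub hε hu₄ hv₄)

lemma slabC1_speed (hJ : Icc 1 b ⊆ J) : SlabC1 1 b fun t x => exp (u.η t x - u.lam t x) := by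
  obtain ⟨hu₁, hu₂, -, -⟩ := u.slabC1 hJ
  exact (ContDiffOn.sub hu₁ hu₂).exp

lemma slabC1_flux (hJ : Icc 1 b ⊆ J) (hε : 0 < ε) : SlabC1 1 b (flux u v ε) := by
  obtain ⟨-, -, hu₃, hu₄⟩ := u.slabC1 hJ
  obtain ⟨-, -, hv₃, hv₄⟩ := v.slabC1 hJ
  exact (u.slabC1_speed hJ).mul
    (ContDiffOn.sub (slabC1_smoothAbs_sub hε hu₃ hv₃) (slabC1_smoothAbs_sub hε hu₄ hv₄))

lemma flux_add_one (hJ : Icc 1 b ⊆ J) {t : ℝ} (ht : t ∈ Icc 1 b) (x : ℝ) :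
    flux u v ε t (x + 1) = flux u v ε t x := by
  have ht := hJ ht
  simp only [flux, u.η_per t ht, u.lam_per t ht, u.r_per t ht, u.s_per t ht, v.r_per t ht,
    v.s_per t ht]

lemma exists_state_bound (hJ : Icc 1 b ⊆ J) (c d : ℝ) :
    ∃ M, 0 ≤ M ∧ ∀ t ∈ Icc 1 b, ∀ x ∈ Icc c d,
      |u.η t x| ≤ M ∧ |u.lam t x| ≤ M ∧ |u.r t x| ≤ M ∧ |u.s t x| ≤ M := by
  obtain ⟨h₁, h₂, h₃, h₄⟩ := u.slabC1 hJ
  obtain ⟨M₁, h₁₀, hM₁⟩ := exists_slab_bound h₁.continuousOn c d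
  obtain ⟨M₂, h₂₀, hM₂⟩ := exists_slab_bound h₂.continuousOn c d
  obtain ⟨M₃, h₃₀, hM₃⟩ := exists_slab_bound h₃.continuousOn c d
  obtain ⟨M₄, h₄₀, hM₄⟩ := exists_slab_bound h₄.continuousOn c d
  exact ⟨M₁ + M₂ + M₃ + M₄, by positivity, fun t ht x hx =>
    ⟨(hM₁ t ht x hx).trans (by linarith), (hM₂ t ht x hx).trans (by linarith),
      (hM₃ t ht x hx).trans (by linarith), (hM₄ t ht x hx).trans (by linarith)⟩⟩

lemma exists_energy_inequality (hb : 1 < b) (hJ : Icc 1 b ⊆ J) (c d : ℝ) :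
    ∃ C B, 0 ≤ C ∧ 0 ≤ B ∧ ∀ ε, 0 < ε → ∀ t ∈ Ioo 1 b, ∀ x ∈ Icc c d,
      pderivT (energy u v ε) t x + pderivX (flux u v ε) t x
        ≤ C * energy u v ε t x + B * sqrt ε := by
  obtain ⟨hu₁, hu₂, hu₃, hu₄⟩ := u.slabC1 hJ
  obtain ⟨hv₁, hv₂, hv₃, hv₄⟩ := v.slabC1 hJ
  have ha := u.slabC1_speed hJ
  obtain ⟨Mu, hMu₀, hMu⟩ := u.exists_state_bound hJ c d
  obtain ⟨Mv, hMv₀, hMv⟩ := v.exists_state_bound hJ c d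
  obtain ⟨Mr, hMr₀, hMr⟩ := hv₃.exists_bound hb c d
  obtain ⟨Ms, hMs₀, hMs⟩ := hv₄.exists_bound hb c d
  obtain ⟨A, hA₀, hA⟩ := ha.exists_bound hb c d
  obtain ⟨M, hM⟩ : ∃ M, M = Mu + Mv + b := ⟨_, rfl⟩
  obtain ⟨K₁, hK₁₀, hK₁⟩ := (contDiff_etaRate Λ).exists_abs_sub_le M
  obtain ⟨K₂, hK₂₀, hK₂⟩ := (contDiff_lamRate Λ).exists_abs_sub_le M
  obtain ⟨K₃, hK₃₀, hK₃⟩ := contDiff_charSpeed.exists_abs_sub_le M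
  obtain ⟨K₄, hK₄₀, hK₄⟩ := (contDiff_rDamping Λ).exists_abs_sub_le M
  obtain ⟨K₅, hK₅₀, hK₅⟩ := (contDiff_sDamping Λ).exists_abs_sub_le M
  obtain ⟨K, hK⟩ : ∃ K, K = K₁ + K₂ + K₃ + K₄ + K₅ := ⟨_, rfl⟩
  have hK₀ : 0 ≤ K := by rw [hK]; positivity
  refine ⟨4 * K + 2 * K * (Mr + Ms) + A, 2 * sqrt M, by positivity, by positivity,
    fun ε hε t ht x hx => ?_⟩
  have ht' := Ioo_subset_Icc_self ht
  have htJ := hJ ht'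
  have ht₀ : 0 < t := by linarith [ht.1]
  obtain ⟨bu₁, bu₂, bu₃, bu₄⟩ := hMu t ht' x hx
  obtain ⟨bv₁, bv₂, bv₃, bv₄⟩ := hMv t ht' x hx
  have hMuM : Mu ≤ M := by linarith
  have hMvM : Mv ≤ M := by linarith
  have htM : |t| ≤ M := by rw [abs_of_pos ht₀]; linarith [ht.2]
  have lip {F : ℝ × ℝ × ℝ × ℝ × ℝ → ℝ} {L : ℝ} (hLK : L ≤ K)
      (hL : ∀ t h l r s h' l' r' s' : ℝ, |t| ≤ M → |h| ≤ M → |l| ≤ M → |r| ≤ M → |s| ≤ M →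
      |h'| ≤ M → |l'| ≤ M → |r'| ≤ M → |s'| ≤ M →
      |F (t, h, l, r, s) - F (t, h', l', r', s')|
        ≤ L * (|h - h'| + |l - l'| + |r - r'| + |s - s'|)) :
      |F (u.state t x) - F (v.state t x)| ≤ K * (|u.η t x - v.η t x|
        + |u.lam t x - v.lam t x| + |u.r t x - v.r t x| + |u.s t x - v.s t x|) :=
    (hL _ _ _ _ _ _ _ _ _ htM (bu₁.trans hMuM) (bu₂.trans hMuM) (bu₃.trans hMuM)
      (bu₄.trans hMuM) (bv₁.trans hMvM) (bv₂.trans hMvM) (bv₃.trans hMvM)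
      (bv₄.trans hMvM)).trans (mul_le_mul_of_nonneg_right hLK (by positivity))
  have hderiv {f g : ℝ → ℝ → ℝ} (hf : SlabC1 1 b f) (hg : SlabC1 1 b g) :
      HasDerivAt (fun τ => smoothAbs ε (f τ x - g τ x))
        (smoothSign ε (f t x - g t x) * (pderivT f t x - pderivT g t x)) t ∧
      HasDerivAt (fun y => smoothAbs ε (f t y - g t y))
        (smoothSign ε (f t x - g t x) * (pderivX f t x - pderivX g t x)) x :=
    ⟨(hasDerivAt_smoothAbs hε _).comp t
        ((hf.hasDerivAt_pderivT ht x).sub (hg.hasDerivAt_pderivT ht x)),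
      (hasDerivAt_smoothAbs hε _).comp x
        ((hf.hasDerivAt_pderivX ht x).sub (hg.hasDerivAt_pderivX ht x))⟩
  have hE : pderivT (energy u v ε) t x = _ :=
    ((((hderiv hu₁ hv₁).1.add (hderiv hu₂ hv₂).1).add (hderiv hu₃ hv₃).1).add
      (hderiv hu₄ hv₄).1).deriv
  have hF : pderivX (flux u v ε) t x = _ :=
    ((ha.hasDerivAt_pderivX ht x).mul ((hderiv hu₃ hv₃).2.sub (hderiv hu₄ hv₄).2)).deriv
  rw [hE, hF, mul_assoc 2 (sqrt M)]
  refine energy_rate_le (M := Mr + Ms)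
    (D := sqrt (u.r t x * u.s t x) - sqrt (v.r t x * v.s t x))
    (r₂x := pderivX v.r t x) (s₂x := pderivX v.s t x)
    (da := charSpeed (u.state t x) - charSpeed (v.state t x))
    (p₄ := rDamping Λ (u.state t x) - rDamping Λ (v.state t x))
    (p₅ := sDamping Λ (u.state t x) - sDamping Λ (v.state t x))
    ht.1.le hK₀ (by positivity)
    (?_ : _ = etaRate Λ (u.state t x) - etaRate Λ (v.state t x))
    (?_ : _ = lamRate Λ (u.state t x) - lamRate Λ (v.state t x)) ?_ ?_
    (lip (by linarith) hK₁) (lip (by linarith) hK₂) (lip (by linarith) hK₄)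
    (lip (by linarith) hK₅) (lip (by linarith) hK₃)
    ((hMr t ht x hx).2.2.trans (by linarith)) ((hMs t ht x hx).2.2.trans (by linarith))
    (hA t ht x hx).2.2 (by positivity) ?_
  · rw [u.pderivT_η_eq htJ ht₀, v.pderivT_η_eq htJ ht₀]; ring
  · rw [u.pderivT_lam_eq htJ ht₀, v.pderivT_lam_eq htJ ht₀]; ring
  · have h₁ := u.transport_r htJ ht₀ x
    have h₂ := v.transport_r htJ ht₀ x
    change _ + charSpeed (u.state t x) * _ = _
    linear_combination h₁ - h₂
  · have h₁ := u.transport_s htJ ht₀ x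
    have h₂ := v.transport_s htJ ht₀ x
    change _ - charSpeed (u.state t x) * _ = _
    linear_combination h₁ - h₂
  · exact neg_smoothSign_add_mul_le hε (u.r_nonneg t htJ x) (v.r_nonneg t htJ x)
      (u.s_nonneg t htJ x) (v.s_nonneg t htJ x)
      ((le_of_abs_le bu₃).trans hMuM) ((le_of_abs_le bv₃).trans hMvM)
      ((le_of_abs_le bu₄).trans hMuM) ((le_of_abs_le bv₄).trans hMvM)

/-- Regular solutions with the same initial data have the same Riemann invariants. -/
lemma eq_of_eq_initial (hJ : Icc 1 b ⊆ J) (hb : 1 < b) (hη : ∀ x, u.η 1 x = v.η 1 x)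
    (hlam : ∀ x, u.lam 1 x = v.lam 1 x) (hr : ∀ x, u.r 1 x = v.r 1 x)
    (hs : ∀ x, u.s 1 x = v.s 1 x) (c : ℝ) : u.r b c = v.r b c ∧ u.s b c = v.s b c := by
  obtain ⟨C, B, hC, hB, hCB⟩ := u.exists_energy_inequality v hb hJ c (c + 1)
  have hbI : b ∈ Icc 1 b := right_mem_Icc.2 hb.le
  set w : ℝ → ℝ := fun x => |u.r b x - v.r b x| + |u.s b x - v.s b x| with hw
  have hwc : Continuous w := by
    obtain ⟨-, -, hu₃, hu₄⟩ := u.slabC1 hJ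
    obtain ⟨-, -, hv₃, hv₄⟩ := v.slabC1 hJ
    exact ((hu₃.continuous_slice hbI).sub (hv₃.continuous_slice hbI)).abs.add
      ((hu₄.continuous_slice hbI).sub (hv₄.continuous_slice hbI)).abs
  have hle : ∀ ε, 0 < ε → ∫ x in c..(c + 1), w x
      ≤ exp (C * (b - 1)) * (4 * ε + B * sqrt ε * (b - 1)) := by
    intro ε hε
    have hg := u.slabC1_energy v hJ hε
    have hmain := hg.integral_le_of_pderiv_le (u.slabC1_flux v hJ hε) hb zero_le_one hC
      (mul_nonneg hB (sqrt_nonneg ε)) (fun t ht x => u.flux_add_one v hJ ht x) (hCB ε hε)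
    have hinit : energy u v ε 1 = fun _ => 4 * ε := by
      funext x
      simp only [energy, hη, hlam, hr, hs, sub_self, smoothAbs_zero hε]
      ring
    simp only [hinit, intervalIntegral.integral_const, smul_eq_mul, add_sub_cancel_left,
      one_mul] at hmain
    refine (intervalIntegral.integral_mono_on (by linarith) (hwc.intervalIntegrable _ _)
      ((hg.continuous_slice hbI).intervalIntegrable _ _) fun x _ => ?_).trans hmain
    have h₁ := abs_le_smoothAbs ε (u.r b x - v.r b x)
    have h₂ := abs_le_smoothAbs ε (u.s b x - v.s b x)
    have h₃ : 0 ≤ smoothAbs ε (u.η b x - v.η b x) := sqrt_nonneg _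
    have h₄ : 0 ≤ smoothAbs ε (u.lam b x - v.lam b x) := sqrt_nonneg _
    simp only [hw, energy]
    linarith
  have hint : ∫ x in c..(c + 1), w x ≤ 0 := by
    have hlim : Filter.Tendsto
        (fun ε : ℝ => exp (C * (b - 1)) * (4 * ε + B * sqrt ε * (b - 1)))
        (nhdsWithin 0 (Ioi 0)) (nhds 0) := by
      have hcont : Continuous
          fun ε : ℝ => exp (C * (b - 1)) * (4 * ε + B * sqrt ε * (b - 1)) := by fun_prop
      simpa using (hcont.tendsto 0).mono_left nhdsWithin_le_nhds
    refine ge_of_tendsto hlim ?_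
    filter_upwards [self_mem_nhdsWithin] with ε hε using hle ε hε
  have hw₀ : ∀ x, 0 ≤ w x := fun x => by positivity
  have hwz : w c = 0 := by
    by_contra hne
    exact hint.not_gt <| intervalIntegral.integral_pos (by linarith)
      hwc.continuousOn (fun x _ => hw₀ x)
      ⟨c, left_mem_Icc.2 (by linarith), (hw₀ c).lt_of_ne' hne⟩
  have h₁ := abs_nonneg (u.r b c - v.r b c)
  have h₂ := abs_nonneg (u.s b c - v.s b c)
  simp only [hw] at hwz
  exact ⟨sub_eq_zero.1 (abs_eq_zero.1 (by linarith)), sub_eq_zero.1 (abs_eq_zero.1 (by linarith))⟩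

end RegularSolution

/-- Uniqueness in the fluid variables (Theorem 3.3): the densities `μᵢ = √(rᵢ sᵢ)` coincide,
and where the common density is positive the velocities `uᵢ = (√rᵢ − √sᵢ)/(√rᵢ + √sᵢ)`
coincide as well. -/
theorem uniqueness_fluid_variables (Λ : ℝ) (hΛ : 0 < Λ) (T : EReal) (hT : 1 < T)
    (sol₁ sol₂ : RegularSolution Λ (timeSlab T))
    (hη : ∀ x : ℝ, sol₁.η 1 x = sol₂.η 1 x)
    (hlam : ∀ x : ℝ, sol₁.lam 1 x = sol₂.lam 1 x)
    (hr : ∀ x : ℝ, sol₁.r 1 x = sol₂.r 1 x)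
    (hs : ∀ x : ℝ, sol₁.s 1 x = sol₂.s 1 x) :
    ∀ t ∈ timeSlab T, ∀ x : ℝ,
      Real.sqrt (sol₁.r t x * sol₁.s t x) = Real.sqrt (sol₂.r t x * sol₂.s t x) ∧
      (0 < Real.sqrt (sol₁.r t x * sol₁.s t x) →
        (Real.sqrt (sol₁.r t x) - Real.sqrt (sol₁.s t x)) /
            (Real.sqrt (sol₁.r t x) + Real.sqrt (sol₁.s t x))
          = (Real.sqrt (sol₂.r t x) - Real.sqrt (sol₂.s t x)) /
            (Real.sqrt (sol₂.r t x) + Real.sqrt (sol₂.s t x))) := by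
  intro t ht x
  have key : sol₁.r t x = sol₂.r t x ∧ sol₁.s t x = sol₂.s t x := by
    rcases ht.1.eq_or_lt with rfl | h1t
    · exact ⟨hr x, hs x⟩
    · have hJ : Icc 1 t ⊆ timeSlab T := fun τ hτ =>
        ⟨hτ.1, (EReal.coe_le_coe_iff.2 hτ.2).trans_lt ht.2⟩
      exact sol₁.eq_of_eq_initial sol₂ hJ h1t hη hlam hr hs x
  rw [key.1, key.2]
  exact ⟨rfl, fun _ => rfl⟩
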